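/- arXiv:1902.00945 — 2 statements merged into one kernel-verified Lean document; each statement's English description precedes it below -/
import Mathlib

section
/- Let f be continuously differentiable on [−1,1]. Then the M-type expansion of f converges uniformly to f on [−1,1]: sup_{t ∈ [−1,1]} |f(t) − f_k(t)| → 0 as k → ∞; in fact sup_{t ∈ [−1,1]} |f(t) − f_k(t)| ≤ √2 · ( ∫_{−1}^{1} (f'(t) − f_k'(t))² dt )^{1/2} for every k ≥ 1. -/
open intervalIntegral

/-- The Legendre polynomial `l_j(t) = (1/(2^j j!)) (d/dt)^j (t²−1)^j`. -/
noncomputable def legendreP (j : ℕ) (t : ℝ) : ℝ :=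
  (1 / (2 ^ j * (Nat.factorial j : ℝ))) * iteratedDeriv j (fun x : ℝ => (x ^ 2 - 1) ^ j) t

/-- The M-type polynomials: `M_0(t) = 1`, `M_1(t) = t`, and
    `M_{k+1}(t) = (1/(2^k k!)) (d/dt)^{k−1} (t²−1)^k` for `k ≥ 1`. -/
noncomputable def Mpoly : ℕ → ℝ → ℝ
  | 0, _ => 1
  | 1, t => t
  | (k + 2), t =>
      (1 / (2 ^ (k + 1) * (Nat.factorial (k + 1) : ℝ))) *
        iteratedDeriv k (fun x : ℝ => (x ^ 2 - 1) ^ (k + 1)) t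

/-- The M-type coefficients of `f` (with derivative `f'` on `[-1,1]`):
    `b_0 = (f(1)+f(−1))/2`, `b_j = (j − 1/2) ∫_{−1}^{1} f'(t) l_{j−1}(t) dt` for `j ≥ 1`. -/
noncomputable def mcoeff (f f' : ℝ → ℝ) : ℕ → ℝ
  | 0 => (f 1 + f (-1)) / 2
  | (j + 1) => (((j : ℝ) + 1) - 1 / 2) * ∫ t in (-1:ℝ)..1, f' t * legendreP j t

/-- The degree-`k` M-type projection `f_k(t) = Σ_{j=0}^{k} b_j M_j(t)`. -/
noncomputable def mproj (f f' : ℝ → ℝ) (k : ℕ) (t : ℝ) : ℝ :=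
  ∑ j ∈ Finset.range (k + 1), mcoeff f f' j * Mpoly j t

section Legendre

open Polynomial

theorem iteratedDeriv_polynomial_eval (p : ℝ[X]) (n : ℕ) :
    iteratedDeriv n (fun x => p.eval x) = fun x => (derivative^[n] p).eval x := by
  induction n with
  | zero => simp
  | succ n ih =>
    rw [iteratedDeriv_succ, ih, Function.iterate_succ_apply']
    ext x
    exact Polynomial.deriv _

theorem integral_derivative_eval (p : ℝ[X]) (a b : ℝ) :
    ∫ t in a..b, (derivative p).eval t = p.eval b - p.eval a :=
  intervalIntegral.integral_eq_sub_of_hasDerivAt (fun t _ => p.hasDerivAt t)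
    ((derivative p).continuous.intervalIntegrable _ _)

theorem eval_iterate_derivative_pow_eq_zero {n i : ℕ} (hi : i < n) {x : ℝ} (hx : x ^ 2 = 1) :
    (derivative^[i] ((X ^ 2 - 1 : ℝ[X]) ^ n)).eval x = 0 := by
  have h := pow_sub_dvd_iterate_derivative_of_pow_dvd i (dvd_refl ((X ^ 2 - 1 : ℝ[X]) ^ n))
  refine eval_eq_zero_of_dvd_of_eval_eq_zero h ?_
  simp [hx, Nat.sub_ne_zero_of_lt hi]

theorem integral_iterate_derivative_pow_mul (n : ℕ) (q : ℝ[X]) {i : ℕ} (hi : i ≤ n) :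
    ∫ t in (-1 : ℝ)..1, (derivative^[i] ((X ^ 2 - 1 : ℝ[X]) ^ n) * q).eval t =
      (-1) ^ i * ∫ t in (-1 : ℝ)..1, ((X ^ 2 - 1 : ℝ[X]) ^ n * derivative^[i] q).eval t := by
  induction i generalizing q with
  | zero => simp
  | succ i ih =>
    have h := integral_derivative_eval (derivative^[i] ((X ^ 2 - 1 : ℝ[X]) ^ n) * q) (-1) 1
    rw [derivative_mul] at h
    simp only [eval_add] at h
    rw [intervalIntegral.integral_add (Polynomial.continuous _ |>.intervalIntegrable _ _)
      (Polynomial.continuous _ |>.intervalIntegrable _ _), ih _ (by omega)] at h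
    rw [eval_mul, eval_mul, eval_iterate_derivative_pow_eq_zero hi (by norm_num),
      eval_iterate_derivative_pow_eq_zero hi (by norm_num)] at h
    rw [Function.iterate_succ_apply', Function.iterate_succ_apply, pow_succ (-1 : ℝ)]
    linarith

theorem integral_sq_sub_one_pow (n : ℕ) :
    (∫ t in (-1 : ℝ)..1, ((X ^ 2 - 1 : ℝ[X]) ^ n).eval t) * (2 * n + 1).factorial =
      (-1) ^ n * 2 * (2 ^ n * n.factorial) ^ 2 := by
  induction n with
  | zero => norm_num
  | succ n ih =>
    have h := integral_derivative_eval (X * (X ^ 2 - 1 : ℝ[X]) ^ (n + 1)) (-1) 1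
    have hd : derivative (X * (X ^ 2 - 1 : ℝ[X]) ^ (n + 1)) =
        C (2 * n + 3 : ℝ) * (X ^ 2 - 1) ^ (n + 1) + C (2 * n + 2 : ℝ) * (X ^ 2 - 1) ^ n := by
      simp only [derivative_mul, derivative_X, derivative_pow, derivative_sub, derivative_one,
        C_add, C_mul, map_natCast, map_ofNat]
      push_cast
      ring
    rw [hd] at h
    simp only [eval_add, eval_C_mul] at h
    rw [intervalIntegral.integral_add, intervalIntegral.integral_const_mul,
      intervalIntegral.integral_const_mul] at h
    rotate_left
    · exact ((Polynomial.continuous _).const_mul _).intervalIntegrable _ _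
    · exact ((Polynomial.continuous _).const_mul _).intervalIntegrable _ _
    simp only [eval_mul, eval_pow, eval_sub, eval_X, eval_one] at h ih ⊢
    norm_num at h
    rw [show 2 * (n + 1) + 1 = 2 * n + 1 + 1 + 1 by ring, Nat.factorial_succ (2 * n + 1 + 1),
      Nat.factorial_succ (2 * n + 1), Nat.factorial_succ n]
    push_cast
    linear_combination (2 * n + 2) * ((2 * n + 1).factorial : ℝ) * h - (2 * n + 2) ^ 2 * ih

theorem iterate_derivative_eq_C_of_natDegree_le {p : ℝ[X]} {n : ℕ} (hp : p.natDegree ≤ n) :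
    derivative^[n] p = C (n.factorial * p.coeff n) := by
  ext m
  rw [coeff_iterate_derivative, coeff_C]
  split_ifs with hm
  · simp [hm, Nat.descFactorial_self]
  · rw [coeff_eq_zero_of_natDegree_lt (by omega), smul_zero]

/-- The Legendre polynomial of degree `j`, given by the Rodrigues formula. -/
noncomputable def legendrePoly (j : ℕ) : ℝ[X] :=
  C (1 / (2 ^ j * (j.factorial : ℝ))) * derivative^[j] ((X ^ 2 - 1) ^ j)

theorem legendreP_eq_eval (j : ℕ) (t : ℝ) : legendreP j t = (legendrePoly j).eval t := by
  have h := congrFun (iteratedDeriv_polynomial_eval ((X ^ 2 - 1) ^ j) j) t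
  simp only [eval_pow, eval_sub, eval_X, eval_one] at h
  rw [legendreP, legendrePoly, eval_C_mul, h]

theorem monic_sq_sub_one_pow (j : ℕ) : ((X ^ 2 - 1 : ℝ[X]) ^ j).Monic :=
  (monic_X_pow_sub_C (1 : ℝ) two_ne_zero).pow j

theorem natDegree_sq_sub_one_pow (j : ℕ) : ((X ^ 2 - 1 : ℝ[X]) ^ j).natDegree = 2 * j := by
  rw [natDegree_pow, show (X ^ 2 - 1 : ℝ[X]) = X ^ 2 - C 1 by simp, natDegree_X_pow_sub_C, mul_comm]

theorem natDegree_legendrePoly_le (j : ℕ) : (legendrePoly j).natDegree ≤ j := by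
  refine (natDegree_C_mul_le _ _).trans ((natDegree_iterate_derivative _ _).trans ?_)
  rw [natDegree_sq_sub_one_pow]
  omega

theorem coeff_sq_sub_one_pow (j : ℕ) : ((X ^ 2 - 1 : ℝ[X]) ^ j).coeff (2 * j) = 1 := by
  rw [← natDegree_sq_sub_one_pow j]
  exact monic_sq_sub_one_pow j

theorem coeff_legendrePoly_self_ne_zero (j : ℕ) : (legendrePoly j).coeff j ≠ 0 := by
  rw [legendrePoly, coeff_C_mul, coeff_iterate_derivative, ← two_mul, coeff_sq_sub_one_pow]
  have : (2 * j).descFactorial j ≠ 0 := by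
    rw [Ne, Nat.descFactorial_eq_zero_iff_lt]
    omega
  have := j.factorial_ne_zero
  simp [*]

theorem integral_legendrePoly_mul (j : ℕ) (q : ℝ[X]) :
    ∫ t in (-1 : ℝ)..1, (legendrePoly j * q).eval t =
      1 / (2 ^ j * (j.factorial : ℝ)) *
        ((-1) ^ j * ∫ t in (-1 : ℝ)..1, ((X ^ 2 - 1 : ℝ[X]) ^ j * derivative^[j] q).eval t) := by
  rw [← integral_iterate_derivative_pow_mul j q le_rfl, ← intervalIntegral.integral_const_mul]
  simp only [legendrePoly, mul_assoc, eval_C_mul]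

theorem integral_legendrePoly_mul_of_lt {i j : ℕ} (h : i < j) :
    ∫ t in (-1 : ℝ)..1, (legendrePoly j * legendrePoly i).eval t = 0 := by
  rw [integral_legendrePoly_mul,
    iterate_derivative_eq_zero ((natDegree_legendrePoly_le i).trans_lt h)]
  simp

theorem integral_legendrePoly_mul_of_ne {i j : ℕ} (h : i ≠ j) :
    ∫ t in (-1 : ℝ)..1, (legendrePoly i * legendrePoly j).eval t = 0 := by
  rcases h.lt_or_gt with h | h
  · rw [mul_comm]
    exact integral_legendrePoly_mul_of_lt h
  · exact integral_legendrePoly_mul_of_lt h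

theorem integral_legendrePoly_mul_self (j : ℕ) :
    ∫ t in (-1 : ℝ)..1, (legendrePoly j * legendrePoly j).eval t = 2 / (2 * j + 1) := by
  have hd : derivative^[j] (legendrePoly j) =
      C (1 / (2 ^ j * (j.factorial : ℝ)) * (2 * j).factorial) := by
    rw [legendrePoly, iterate_derivative_C_mul, ← Function.iterate_add_apply, ← two_mul,
      iterate_derivative_eq_C_of_natDegree_le (natDegree_sq_sub_one_pow j).le,
      coeff_sq_sub_one_pow, mul_one, C_mul]
  have h := integral_sq_sub_one_pow j
  rw [integral_legendrePoly_mul, hd]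
  simp only [eval_mul, eval_C]
  rw [intervalIntegral.integral_mul_const]
  rw [Nat.factorial_succ] at h
  push_cast at h
  have h1 : (j.factorial : ℝ) ≠ 0 := by exact_mod_cast j.factorial_ne_zero
  have h2 : (2 * j + 1 : ℝ) ≠ 0 := by positivity
  have h3 : ((-1 : ℝ) ^ j) * (-1) ^ j = 1 := by rw [← mul_pow]; simp
  field_simp
  linear_combination (-1) ^ j * h + (2 * (2 ^ j * (j.factorial:ℝ)) ^ 2) * h3

theorem exists_eq_sum_legendrePoly (k : ℕ) (q : ℝ[X]) (hq : q.degree < k) :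
    ∃ a : ℕ → ℝ, q = ∑ j ∈ Finset.range k, C (a j) * legendrePoly j := by
  induction k generalizing q with
  | zero =>
    refine ⟨0, ?_⟩
    simpa using hq
  | succ k ih =>
    set c := q.coeff k / (legendrePoly k).coeff k with hc
    obtain ⟨a, ha⟩ := ih (q - C c * legendrePoly k) (by
      rw [degree_lt_iff_coeff_zero] at hq ⊢
      intro m hm
      rw [coeff_sub, coeff_C_mul]
      rcases hm.eq_or_lt with rfl | hm
      · rw [hc, div_mul_cancel₀ _ (coeff_legendrePoly_self_ne_zero k), sub_self]
      · rw [hq m hm, coeff_eq_zero_of_natDegree_lt ((natDegree_legendrePoly_le k).trans_lt hm)]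
        simp)
    refine ⟨Function.update a k c, ?_⟩
    rw [Finset.sum_range_succ, Function.update_self, ← sub_eq_iff_eq_add, ha]
    refine Finset.sum_congr rfl fun j hj => ?_
    rw [Function.update_of_ne (Finset.mem_range.mp hj).ne]

theorem hasDerivAt_Mpoly_succ (j : ℕ) (t : ℝ) :
    HasDerivAt (Mpoly (j + 1)) (legendreP j t) t := by
  cases j with
  | zero =>
    have h : legendreP 0 t = 1 := by simp [legendreP]
    rw [h]
    exact hasDerivAt_id t
  | succ j =>
    have h := iteratedDeriv_polynomial_eval ((X ^ 2 - 1) ^ (j + 1)) j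
    simp only [eval_pow, eval_sub, eval_X, eval_one] at h
    have hM : Mpoly (j + 2) = fun t => 1 / (2 ^ (j + 1) * ((j + 1).factorial : ℝ)) *
        (derivative^[j] ((X ^ 2 - 1 : ℝ[X]) ^ (j + 1))).eval t := by
      ext t
      rw [Mpoly, h]
    rw [hM, legendreP_eq_eval, legendrePoly, eval_C_mul, Function.iterate_succ_apply']
    exact (Polynomial.hasDerivAt _ t).const_mul _

theorem Mpoly_neg_one (j : ℕ) : Mpoly (j + 2) (-1) = 0 := by
  have h := congrFun (iteratedDeriv_polynomial_eval ((X ^ 2 - 1) ^ (j + 1)) j) (-1)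
  simp only [eval_pow, eval_sub, eval_X, eval_one] at h
  rw [Mpoly, h, eval_iterate_derivative_pow_eq_zero (by omega) (by norm_num), mul_zero]

/-- The degree-`< k` Legendre expansion of `g` on `[-1, 1]`, as a polynomial. -/
noncomputable def legendreProj (g : ℝ → ℝ) (k : ℕ) : ℝ[X] :=
  ∑ j ∈ Finset.range k,
    C (((j : ℝ) + 1 / 2) * ∫ t in (-1 : ℝ)..1, g t * (legendrePoly j).eval t) * legendrePoly j

theorem hasDerivAt_mproj (f f' : ℝ → ℝ) (k : ℕ) (t : ℝ) :
    HasDerivAt (mproj f f' k) ((legendreProj f' k).eval t) t := by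
  have h : HasDerivAt (fun t => ∑ j ∈ Finset.range k, mcoeff f f' (j + 1) * Mpoly (j + 1) t
      + mcoeff f f' 0) (∑ j ∈ Finset.range k, mcoeff f f' (j + 1) * legendreP j t) t :=
    (HasDerivAt.fun_sum fun j _ => (hasDerivAt_Mpoly_succ j t).const_mul _).add_const _
  convert h using 1
  · ext t
    rw [mproj, Finset.sum_range_succ', Mpoly, mul_one]
  · rw [legendreProj, eval_finsetSum]
    refine Finset.sum_congr rfl fun j _ => ?_
    simp only [eval_C_mul, mcoeff, legendreP_eq_eval]
    ring

theorem intervalIntegrable_of_continuousOn_Icc {h : ℝ → ℝ}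
    (hh : ContinuousOn h (Set.Icc (-1 : ℝ) 1)) :
    IntervalIntegrable h MeasureTheory.volume (-1) 1 :=
  hh.intervalIntegrable_of_Icc (by norm_num)

theorem integral_sub_legendreProj_mul_legendrePoly {g : ℝ → ℝ}
    (hg : ContinuousOn g (Set.Icc (-1 : ℝ) 1)) {i k : ℕ} (hi : i < k) :
    ∫ t in (-1 : ℝ)..1, (g t - (legendreProj g k).eval t) * (legendrePoly i).eval t = 0 := by
  simp only [sub_mul, legendreProj, eval_finsetSum, Finset.sum_mul]
  rw [intervalIntegral.integral_sub
    (intervalIntegrable_of_continuousOn_Icc (hg.fun_mul (Polynomial.continuousOn _)))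
    (Continuous.intervalIntegrable (by fun_prop) _ _),
    intervalIntegral.integral_finsetSum
      fun j _ => Continuous.intervalIntegrable (by fun_prop) _ _,
    Finset.sum_eq_single_of_mem i (Finset.mem_range.mpr hi)]
  · have h := integral_legendrePoly_mul_self i
    simp only [eval_mul] at h
    simp only [eval_C_mul, mul_assoc, intervalIntegral.integral_const_mul]
    rw [h]
    have : (2 * i + 1 : ℝ) ≠ 0 := by positivity
    field_simp
    ring
  · intro j _ hj
    have h := integral_legendrePoly_mul_of_ne hj
    simp only [eval_mul] at h
    simp only [eval_C_mul, mul_assoc, intervalIntegral.integral_const_mul]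
    rw [h]
    simp

theorem integral_sub_legendreProj_mul {g : ℝ → ℝ}
    (hg : ContinuousOn g (Set.Icc (-1 : ℝ) 1)) {k : ℕ} {q : ℝ[X]} (hq : q.degree < k) :
    ∫ t in (-1 : ℝ)..1, (g t - (legendreProj g k).eval t) * q.eval t = 0 := by
  obtain ⟨a, rfl⟩ := exists_eq_sum_legendrePoly k q hq
  simp only [eval_finsetSum, Finset.mul_sum, eval_C_mul]
  rw [intervalIntegral.integral_finsetSum fun j _ => intervalIntegrable_of_continuousOn_Icc
    ((hg.fun_sub (Polynomial.continuousOn _)).fun_mul (Polynomial.continuousOn _ |>.const_mul _))]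
  refine Finset.sum_eq_zero fun j hj => ?_
  simp only [mul_left_comm _ (a j)]
  rw [intervalIntegral.integral_const_mul,
    integral_sub_legendreProj_mul_legendrePoly hg (Finset.mem_range.mp hj), mul_zero]

theorem degree_legendreProj_lt (g : ℝ → ℝ) (k : ℕ) : (legendreProj g k).degree < k := by
  rw [degree_lt_iff_coeff_zero]
  intro m hm
  rw [legendreProj, finsetSum_coeff]
  refine Finset.sum_eq_zero fun j hj => ?_
  rw [coeff_C_mul, coeff_eq_zero_of_natDegree_lt, mul_zero]
  exact (natDegree_legendrePoly_le j).trans_lt ((Finset.mem_range.mp hj).trans_le hm)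

/-- The Legendre expansion is the best `L²` approximation among polynomials of degree `< k`. -/
theorem integral_sub_legendreProj_sq_le {g : ℝ → ℝ}
    (hg : ContinuousOn g (Set.Icc (-1 : ℝ) 1)) {k : ℕ} {p : ℝ[X]} (hp : p.degree < k) :
    ∫ t in (-1 : ℝ)..1, (g t - (legendreProj g k).eval t) ^ 2 ≤
      ∫ t in (-1 : ℝ)..1, (g t - p.eval t) ^ 2 := by
  have horth := integral_sub_legendreProj_mul hg
    ((degree_sub_le _ _).trans_lt (max_lt (degree_legendreProj_lt g k) hp))
  have hs := hg.fun_sub (legendreProj g k).continuousOn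
  have hi := intervalIntegrable_of_continuousOn_Icc (hs.fun_pow 2)
  have hm := intervalIntegrable_of_continuousOn_Icc
    (hs.fun_mul (legendreProj g k - p).continuousOn)
  calc ∫ t in (-1 : ℝ)..1, (g t - (legendreProj g k).eval t) ^ 2
      = ∫ t in (-1 : ℝ)..1, ((g t - (legendreProj g k).eval t) ^ 2 +
          2 * ((g t - (legendreProj g k).eval t) * (legendreProj g k - p).eval t)) := by
        rw [intervalIntegral.integral_add hi (hm.const_mul 2),
          intervalIntegral.integral_const_mul, horth, mul_zero, add_zero]
    _ ≤ ∫ t in (-1 : ℝ)..1, (g t - p.eval t) ^ 2 := by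
        refine intervalIntegral.integral_mono_on (by norm_num) (hi.add (hm.const_mul 2))
          (intervalIntegrable_of_continuousOn_Icc ((hg.sub p.continuousOn).pow 2)) fun t _ => ?_
        rw [eval_sub]
        nlinarith [sq_nonneg ((legendreProj g k).eval t - p.eval t)]

theorem integral_abs_le_sqrt_two_mul {h : ℝ → ℝ} (hh : ContinuousOn h (Set.Icc (-1 : ℝ) 1)) :
    ∫ t in (-1 : ℝ)..1, |h t| ≤ Real.sqrt 2 * Real.sqrt (∫ t in (-1 : ℝ)..1, h t ^ 2) := by
  set A := ∫ t in (-1 : ℝ)..1, |h t| with hA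
  have ha := intervalIntegrable_of_continuousOn_Icc hh.abs
  have hi := intervalIntegrable_of_continuousOn_Icc (hh.fun_pow 2)
  have hnonneg : 0 ≤ ∫ t in (-1 : ℝ)..1, (|h t| - A / 2) ^ 2 :=
    intervalIntegral.integral_nonneg (by norm_num) fun t _ => sq_nonneg _
  have hexp : ∀ t, (|h t| - A / 2) ^ 2 = h t ^ 2 - A * |h t| + A ^ 2 / 4 := fun t => by
    rw [← sq_abs (h t)]
    ring
  simp only [hexp] at hnonneg
  rw [intervalIntegral.integral_add (hi.sub (ha.const_mul A)) intervalIntegrable_const,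
    intervalIntegral.integral_sub hi (ha.const_mul A), intervalIntegral.integral_const_mul, ← hA,
    intervalIntegral.integral_const, smul_eq_mul] at hnonneg
  rw [← Real.sqrt_mul (by norm_num)]
  exact Real.le_sqrt_of_sq_le (by linarith)

theorem abs_le_integral_abs_of_hasDerivWithinAt {e h : ℝ → ℝ}
    (he : ∀ t ∈ Set.Icc (-1 : ℝ) 1, HasDerivWithinAt e (h t) (Set.Icc (-1 : ℝ) 1) t)
    (hh : ContinuousOn h (Set.Icc (-1 : ℝ) 1)) (h0 : e (-1) = 0)
    {t : ℝ} (ht : t ∈ Set.Icc (-1 : ℝ) 1) :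
    |e t| ≤ ∫ s in (-1 : ℝ)..1, |h s| := by
  have hsub : Set.Icc (-1) t ⊆ Set.Icc (-1 : ℝ) 1 := Set.Icc_subset_Icc_right ht.2
  have hint := (hh.mono hsub).intervalIntegrable_of_Icc (μ := MeasureTheory.volume) ht.1
  have hftc : ∫ s in (-1 : ℝ)..t, h s = e t - e (-1) :=
    intervalIntegral.integral_eq_sub_of_hasDerivAt_of_le ht.1
      (fun s hs => (he s (hsub hs)).continuousWithinAt.mono hsub)
      (fun s hs => (he s (hsub (Set.Ioo_subset_Icc_self hs))).hasDerivAt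
        (Icc_mem_nhds hs.1 (hs.2.trans_le ht.2))) hint
  rw [h0, sub_zero] at hftc
  rw [← hftc]
  exact (intervalIntegral.abs_integral_le_integral_abs ht.1).trans
    (intervalIntegral.integral_mono_interval le_rfl ht.1 ht.2
      (Filter.Eventually.of_forall fun s => abs_nonneg _)
      (intervalIntegrable_of_continuousOn_Icc hh.abs))

theorem mproj_neg_one {f f' : ℝ → ℝ}
    (hf : ∀ t ∈ Set.Icc (-1 : ℝ) 1, HasDerivWithinAt f (f' t) (Set.Icc (-1 : ℝ) 1) t)
    (hf' : ContinuousOn f' (Set.Icc (-1 : ℝ) 1)) {k : ℕ} (hk : 1 ≤ k) :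
    mproj f f' k (-1) = f (-1) := by
  have hftc : ∫ s in (-1 : ℝ)..1, f' s = f 1 - f (-1) :=
    intervalIntegral.integral_eq_sub_of_hasDerivAt_of_le (by norm_num)
      (fun s hs => (hf s hs).continuousWithinAt)
      (fun s hs => (hf s (Set.Ioo_subset_Icc_self hs)).hasDerivAt (Icc_mem_nhds hs.1 hs.2))
      (intervalIntegrable_of_continuousOn_Icc hf')
  obtain ⟨k, rfl⟩ := Nat.exists_eq_add_of_le' hk
  have hl : ∀ t, legendreP 0 t = 1 := fun t => by simp [legendreP]
  rw [mproj, Finset.sum_range_succ', Finset.sum_range_succ',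
    Finset.sum_eq_zero fun j _ => by rw [Mpoly_neg_one, mul_zero]]
  simp only [mcoeff, Mpoly, hl, mul_one, hftc]
  push_cast
  ring

end Legendre

/-- Let `f` be continuously differentiable on `[−1,1]`. Then the M-type
expansion of `f` converges uniformly to `f` on `[−1,1]`; in fact for every `k ≥ 1`,
`sup_{t ∈ [−1,1]} |f(t) − f_k(t)| ≤ √2 · ( ∫_{−1}^{1} (f'(t) − f_k'(t))² dt )^{1/2}`. -/
theorem mproj_uniform_convergence (f f' : ℝ → ℝ)
    (hf : ∀ t ∈ Set.Icc (-1:ℝ) 1, HasDerivWithinAt f (f' t) (Set.Icc (-1:ℝ) 1) t)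
    (hf' : ContinuousOn f' (Set.Icc (-1:ℝ) 1)) :
    (∀ ε > (0 : ℝ), ∃ N : ℕ, ∀ k ≥ N, ∀ t ∈ Set.Icc (-1:ℝ) 1,
      |f t - mproj f f' k t| < ε) ∧
    (∀ k : ℕ, 1 ≤ k → ∀ t ∈ Set.Icc (-1:ℝ) 1,
      |f t - mproj f f' k t| ≤
        Real.sqrt 2 * Real.sqrt (∫ s in (-1:ℝ)..1, (f' s - deriv (mproj f f' k) s) ^ 2)) := by
  have hbound : ∀ k : ℕ, 1 ≤ k → ∀ t ∈ Set.Icc (-1:ℝ) 1, |f t - mproj f f' k t| ≤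
      Real.sqrt 2 * Real.sqrt (∫ s in (-1:ℝ)..1, (f' s - (legendreProj f' k).eval s) ^ 2) := by
    intro k hk t ht
    have hcont := hf'.sub (legendreProj f' k).continuousOn
    exact (abs_le_integral_abs_of_hasDerivWithinAt (e := fun t => f t - mproj f f' k t)
      (fun s hs => (hf s hs).sub (hasDerivAt_mproj f f' k s).hasDerivWithinAt) hcont
      (by rw [mproj_neg_one hf hf' hk, sub_self]) ht).trans (integral_abs_le_sqrt_two_mul hcont)
  refine ⟨fun ε hε => ?_, fun k hk t ht => ?_⟩
  · obtain ⟨p, hp⟩ := exists_polynomial_near_of_continuousOn (-1) 1 f' hf' (ε / 4) (by positivity)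
    refine ⟨p.natDegree + 1, fun k hk t ht => ?_⟩
    have hdeg : p.degree < k := Polynomial.degree_le_natDegree.trans_lt (by exact_mod_cast hk)
    have hsq : ∫ s in (-1:ℝ)..1, (f' s - p.eval s) ^ 2 ≤ 2 * (ε / 4) ^ 2 := by
      calc ∫ s in (-1:ℝ)..1, (f' s - p.eval s) ^ 2
          ≤ ∫ _ in (-1:ℝ)..1, (ε / 4) ^ 2 := by
            refine intervalIntegral.integral_mono_on (by norm_num)
              (intervalIntegrable_of_continuousOn_Icc ((hf'.sub p.continuousOn).pow 2))
              intervalIntegrable_const fun s hs => ?_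
            rw [← sq_abs, abs_sub_comm]
            exact pow_le_pow_left₀ (abs_nonneg _) (hp s hs).le 2
        _ = 2 * (ε / 4) ^ 2 := by
            rw [intervalIntegral.integral_const, smul_eq_mul]
            norm_num
    calc |f t - mproj f f' k t|
        ≤ Real.sqrt 2 * Real.sqrt (∫ s in (-1:ℝ)..1, (f' s - (legendreProj f' k).eval s) ^ 2) :=
          hbound k (by omega) t ht
      _ ≤ Real.sqrt 2 * Real.sqrt (2 * (ε / 4) ^ 2) := by
          gcongr
          exact (integral_sub_legendreProj_sq_le hf' hdeg).trans hsq
      _ = 2 * (ε / 4) := by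
          rw [Real.sqrt_mul (by norm_num), Real.sqrt_sq (by positivity), ← mul_assoc,
            Real.mul_self_sqrt (by norm_num)]
      _ < ε := by linarith
  · simpa only [(hasDerivAt_mproj f f' k _).deriv] using hbound k hk t ht
end

section
/- Let k ≥ 2 be an integer and let f be smooth (C^∞) on the square K̂ = [−1,1]². Then the s-derivative of the Q^k M-type projection remainder has zero mean on K̂: ∬_{[−1,1]²} ∂_s ( f(s,t) − f_{k,k}(s,t) ) ds dt = 0. -/
open intervalIntegral

/-- The 2D M-type coefficients `b_{i,j}` of a function `f` on `[−1,1]²`. -/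
noncomputable def mcoeff2 (f : ℝ → ℝ → ℝ) : ℕ → ℕ → ℝ
  | 0, 0 => (f (-1) (-1) + f (-1) 1 + f 1 (-1) + f 1 1) / 4
  | 0, (j + 1) => ((2 * ((j : ℝ) + 1) - 1) / 4) *
      ∫ t in (-1:ℝ)..1, (deriv (f 1) t + deriv (f (-1)) t) * legendreP j t
  | (i + 1), 0 => ((2 * ((i : ℝ) + 1) - 1) / 4) *
      ∫ s in (-1:ℝ)..1,
        (deriv (fun x => f x 1) s + deriv (fun x => f x (-1)) s) * legendreP i s
  | (i + 1), (j + 1) => ((2 * ((i : ℝ) + 1) - 1) * (2 * ((j : ℝ) + 1) - 1) / 4) *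
      ∫ s in (-1:ℝ)..1, ∫ t in (-1:ℝ)..1,
        deriv (fun x => deriv (f x) t) s * legendreP i s * legendreP j t

/-- The `Q^k` M-type projection `f_{k,k}(s,t) = Σ_{i=0}^{k} Σ_{j=0}^{k} b_{i,j} M_i(s) M_j(t)`. -/
noncomputable def mproj2 (f : ℝ → ℝ → ℝ) (k : ℕ) (s t : ℝ) : ℝ :=
  ∑ i ∈ Finset.range (k + 1), ∑ j ∈ Finset.range (k + 1),
    mcoeff2 f i j * Mpoly i s * Mpoly j t

open Polynomial in
lemma iteratedDeriv_eval_eq (P : ℝ[X]) (n : ℕ) :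
    iteratedDeriv n (fun x : ℝ => P.eval x) = fun x => (derivative^[n] P).eval x := by
  induction n with
  | zero => simp
  | succ n ih =>
    rw [iteratedDeriv_succ, ih, Function.iterate_succ_apply']
    funext x
    exact Polynomial.deriv _

open Polynomial in
lemma iteratedDeriv_sq_sub_one_pow (n m : ℕ) :
    iteratedDeriv n (fun x : ℝ => (x ^ 2 - 1) ^ m) =
      fun x => (derivative^[n] ((X ^ 2 - 1 : ℝ[X]) ^ m)).eval x := by
  rw [← iteratedDeriv_eval_eq]
  simp

open Polynomial in
lemma iteratedDeriv_sq_sub_one_pow_eq_zero {n m : ℕ} (h : n < m) {x : ℝ} (hx : x ^ 2 = 1) :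
    iteratedDeriv n (fun x : ℝ => (x ^ 2 - 1) ^ m) x = 0 := by
  rw [iteratedDeriv_sq_sub_one_pow]
  obtain ⟨Q, hQ⟩ := pow_sub_dvd_iterate_derivative_of_pow_dvd n
    (dvd_refl ((X ^ 2 - 1 : ℝ[X]) ^ m))
  simp only [hQ, eval_mul, eval_pow, eval_sub, eval_X, eval_one, hx, sub_self]
  rw [zero_pow (by omega), zero_mul]

open Polynomial in
lemma contDiff_iteratedDeriv_sq_sub_one_pow (n m : ℕ) {r : WithTop ℕ∞} :
    ContDiff ℝ r (iteratedDeriv n (fun x : ℝ => (x ^ 2 - 1) ^ m)) := by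
  rw [iteratedDeriv_sq_sub_one_pow]
  simpa using Polynomial.contDiff_aeval (𝕜 := ℝ) (derivative^[n] ((X ^ 2 - 1 : ℝ[X]) ^ m)) r

lemma contDiff_Mpoly (j : ℕ) {r : WithTop ℕ∞} : ContDiff ℝ r (Mpoly j) := by
  match j with
  | 0 => exact contDiff_const
  | 1 => exact contDiff_id
  | k + 2 => exact contDiff_const.mul (contDiff_iteratedDeriv_sq_sub_one_pow _ _)

lemma Mpoly_add_two_eq_zero (j : ℕ) {x : ℝ} (hx : x ^ 2 = 1) : Mpoly (j + 2) x = 0 := by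
  simp only [Mpoly, iteratedDeriv_sq_sub_one_pow_eq_zero (Nat.lt_succ_self j) hx, mul_zero]

lemma integral_deriv_of_contDiff {u : ℝ → ℝ} (hu : ContDiff ℝ 1 u) (a b : ℝ) :
    ∫ x in a..b, deriv u x = u b - u a :=
  intervalIntegral.integral_deriv_eq_sub' u rfl
    (fun x _ => hu.differentiable (by simp) x) (hu.continuous_deriv le_rfl).continuousOn

lemma integral_Mpoly_zero : ∫ t in (-1:ℝ)..1, Mpoly 0 t = 2 := by
  simp [Mpoly]; norm_num

lemma integral_Mpoly_one : ∫ t in (-1:ℝ)..1, Mpoly 1 t = 0 := by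
  simp [Mpoly]

lemma integral_Mpoly_two : ∫ t in (-1:ℝ)..1, Mpoly 2 t = -2 / 3 := by
  simp only [Mpoly, iteratedDeriv_zero, intervalIntegral.integral_const_mul, zero_add, pow_one]
  rw [intervalIntegral.integral_sub (by simp) (by simp)]
  simp
  norm_num

lemma integral_Mpoly_add_three (j : ℕ) : ∫ t in (-1:ℝ)..1, Mpoly (j + 3) t = 0 := by
  simp only [Mpoly, intervalIntegral.integral_const_mul]
  rw [iteratedDeriv_succ, integral_deriv_of_contDiff (contDiff_iteratedDeriv_sq_sub_one_pow _ _),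
    iteratedDeriv_sq_sub_one_pow_eq_zero (by omega) (by norm_num),
    iteratedDeriv_sq_sub_one_pow_eq_zero (by omega) (by norm_num), sub_self, mul_zero]

lemma contDiff_section_left {g : ℝ → ℝ → ℝ} {r : WithTop ℕ∞}
    (hg : ContDiff ℝ r (Function.uncurry g)) (t : ℝ) : ContDiff ℝ r (fun s => g s t) :=
  hg.comp (contDiff_id.prodMk contDiff_const)

lemma contDiff_section_right {g : ℝ → ℝ → ℝ} {r : WithTop ℕ∞}
    (hg : ContDiff ℝ r (Function.uncurry g)) (s : ℝ) : ContDiff ℝ r (g s) :=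
  hg.comp (contDiff_const.prodMk contDiff_id)

lemma continuous_partial_deriv_left {g : ℝ → ℝ → ℝ} (hg : ContDiff ℝ 1 (Function.uncurry g)) :
    Continuous fun p : ℝ × ℝ => deriv (fun x => g x p.2) p.1 := by
  have h : (fun p : ℝ × ℝ => deriv (fun x => g x p.2) p.1) =
      fun p => fderiv ℝ (Function.uncurry g) p (1, 0) := by
    funext p
    have h1 := (hg.differentiable (by simp) p).hasFDerivAt
    have h2 : HasDerivAt (fun x : ℝ => (x, p.2)) ((1 : ℝ), (0 : ℝ)) p.1 :=
      (hasDerivAt_id _).prodMk (hasDerivAt_const _ _)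
    exact (h1.comp_hasDerivAt p.1 h2).deriv
  rw [h]
  exact (hg.continuous_fderiv (by simp)).clm_apply continuous_const

lemma contDiff_partial_deriv_right {g : ℝ → ℝ → ℝ}
    (hg : ContDiff ℝ 2 (Function.uncurry g)) :
    ContDiff ℝ 1 (Function.uncurry fun s t => deriv (g s) t) := by
  have h : (Function.uncurry fun s t => deriv (g s) t) =
      fun p => fderiv ℝ (Function.uncurry g) p (0, 1) := by
    funext p
    have h1 := (hg.differentiable (by simp) p).hasFDerivAt
    have h2 : HasDerivAt (fun x : ℝ => (p.1, x)) ((0 : ℝ), (1 : ℝ)) p.2 :=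
      (hasDerivAt_const _ _).prodMk (hasDerivAt_id _)
    exact (h1.comp_hasDerivAt p.2 h2).deriv
  rw [h]
  exact (hg.fderiv_right (m := 1) (by norm_num)).clm_apply contDiff_const

lemma integral_integral_deriv_left_mul {g : ℝ → ℝ → ℝ}
    (hg : ContDiff ℝ 1 (Function.uncurry g)) {w : ℝ → ℝ} (hw : Continuous w) (a b c d : ℝ) :
    ∫ s in a..b, ∫ t in c..d, deriv (fun x => g x t) s * w t =
      ∫ t in c..d, (g b t - g a t) * w t := by
  rw [MeasureTheory.intervalIntegral_intervalIntegral_swap]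
  · refine intervalIntegral.integral_congr fun t _ => ?_
    simp only [intervalIntegral.integral_mul_const]
    rw [integral_deriv_of_contDiff (contDiff_section_left hg t)]
  · have hc : Continuous (Function.uncurry fun s t => deriv (fun x => g x t) s * w t) :=
      (continuous_partial_deriv_left hg).mul (hw.comp continuous_snd)
    exact (hc.continuousOn.integrableOn_compact
      (isCompact_uIcc.prod isCompact_uIcc)).mono_set
      (Set.prod_mono Set.uIoc_subset_uIcc Set.uIoc_subset_uIcc)

lemma mproj2_one_sub_mproj2_neg_one (f : ℝ → ℝ → ℝ) {k : ℕ} (hk : 1 ≤ k) (t : ℝ) :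
    mproj2 f k 1 t - mproj2 f k (-1) t =
      2 * ∑ j ∈ Finset.range (k + 1), mcoeff2 f 1 j * Mpoly j t := by
  obtain ⟨k, rfl⟩ := Nat.exists_eq_add_of_le' hk
  simp only [mproj2]
  rw [← Finset.sum_sub_distrib, Finset.sum_range_succ', Finset.sum_range_succ']
  have h1 (j : ℕ) : Mpoly (j + 1 + 1) 1 = 0 := Mpoly_add_two_eq_zero j (by norm_num)
  have h2 (j : ℕ) : Mpoly (j + 1 + 1) (-1) = 0 := Mpoly_add_two_eq_zero j (by norm_num)
  have h3 (x : ℝ) : Mpoly 0 x = 1 := rfl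
  have h4 (x : ℝ) : Mpoly 1 x = x := rfl
  simp only [h1, h2, h3, h4, zero_add, mul_zero, zero_mul, sub_self, Finset.sum_const_zero,
    add_zero, ← Finset.sum_sub_distrib, Finset.mul_sum]
  refine Finset.sum_congr rfl fun j _ => ?_
  ring

lemma integral_mproj2_one_sub (f : ℝ → ℝ → ℝ) {k : ℕ} (hk : 2 ≤ k) :
    ∫ t in (-1:ℝ)..1, (mproj2 f k 1 t - mproj2 f k (-1) t) =
      4 * mcoeff2 f 1 0 - 4 / 3 * mcoeff2 f 1 2 := by
  simp only [mproj2_one_sub_mproj2_neg_one f (one_le_two.trans hk),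
    intervalIntegral.integral_const_mul]
  rw [intervalIntegral.integral_finsetSum fun j _ =>
    (((contDiff_Mpoly j (r := 1)).continuous).const_mul _).intervalIntegrable _ _]
  obtain ⟨k, rfl⟩ := Nat.exists_eq_add_of_le' hk
  simp only [intervalIntegral.integral_const_mul]
  rw [Finset.sum_range_succ', Finset.sum_range_succ', Finset.sum_range_succ']
  simp only [zero_add, Nat.reduceAdd, add_assoc, integral_Mpoly_zero, integral_Mpoly_one,
    integral_Mpoly_two, integral_Mpoly_add_three]
  simp
  ring

lemma legendreP_zero (t : ℝ) : legendreP 0 t = 1 := by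
  simp [legendreP]

lemma legendreP_one (t : ℝ) : legendreP 1 t = t := by
  simp [legendreP, iteratedDeriv_one]

lemma mcoeff2_one_zero {f : ℝ → ℝ → ℝ} (hf : ContDiff ℝ 1 (Function.uncurry f)) :
    mcoeff2 f 1 0 = (f 1 1 - f (-1) 1 + (f 1 (-1) - f (-1) (-1))) / 4 := by
  have h (t : ℝ) : IntervalIntegrable (deriv fun x => f x t) MeasureTheory.volume (-1) 1 :=
    ((contDiff_section_left hf t).continuous_deriv le_rfl).intervalIntegrable _ _
  simp only [mcoeff2, legendreP_zero, mul_one]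
  rw [intervalIntegral.integral_add (h 1) (h (-1)),
    integral_deriv_of_contDiff (contDiff_section_left hf 1),
    integral_deriv_of_contDiff (contDiff_section_left hf (-1))]
  norm_num
  ring

lemma mcoeff2_one_two {f : ℝ → ℝ → ℝ} (hf : ContDiff ℝ 2 (Function.uncurry f)) :
    mcoeff2 f 1 2 = 3 / 4 * (f 1 1 - f (-1) 1 + (f 1 (-1) - f (-1) (-1)) -
      ∫ t in (-1:ℝ)..1, (f 1 t - f (-1) t)) := by
  have h1 (s : ℝ) : ContDiff ℝ 1 (f s) :=
    (contDiff_section_right hf s).of_le (by norm_num)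
  simp only [mcoeff2, legendreP_zero, legendreP_one, mul_one]
  rw [integral_integral_deriv_left_mul (contDiff_partial_deriv_right hf) continuous_id']
  have h2 := intervalIntegral.integral_mul_deriv_eq_deriv_mul (a := -1) (b := 1)
    (u := fun t : ℝ => t) (u' := fun _ => 1) (v := fun t => f 1 t - f (-1) t)
    (v' := fun t => deriv (f 1) t - deriv (f (-1)) t)
    (fun t _ => hasDerivAt_id t)
    (fun t _ => ((h1 1).differentiable (by simp) t).hasDerivAt.sub
      ((h1 (-1)).differentiable (by simp) t).hasDerivAt)
    (by simp)
    ((((h1 1).continuous_deriv le_rfl).sub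
      ((h1 (-1)).continuous_deriv le_rfl)).intervalIntegrable _ _)
  simp only [one_mul] at h2
  simp only [mul_comm (deriv _ _ - deriv _ _) _]
  rw [h2]
  norm_num
  ring

lemma contDiff_mproj2 (f : ℝ → ℝ → ℝ) (k : ℕ) {r : WithTop ℕ∞} :
    ContDiff ℝ r (Function.uncurry (mproj2 f k)) := by
  have h : Function.uncurry (mproj2 f k) = fun p => ∑ i ∈ Finset.range (k + 1),
    ∑ j ∈ Finset.range (k + 1), mcoeff2 f i j * Mpoly i p.1 * Mpoly j p.2 := rfl
  rw [h]
  refine ContDiff.sum fun i _ => ContDiff.sum fun j _ => ?_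
  exact (contDiff_const.mul ((contDiff_Mpoly i).comp contDiff_fst)).mul
    ((contDiff_Mpoly j).comp contDiff_snd)

/-- Let `k ≥ 2` and let `f` be smooth on `[−1,1]²`. Then the `s`-derivative
of the `Q^k` M-type projection remainder has zero mean on the square:
`∬ ∂_s (f − f_{k,k}) ds dt = 0`. -/
theorem mproj2_remainder_deriv_zero_mean (k : ℕ) (hk : 2 ≤ k) (f : ℝ → ℝ → ℝ)
    (hf : ContDiff ℝ (⊤ : ℕ∞) (Function.uncurry f)) :
    ∫ s in (-1:ℝ)..1, ∫ t in (-1:ℝ)..1,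
      deriv (fun x => f x t - mproj2 f k x t) s = 0 := by
  have hf2 : ContDiff ℝ 2 (Function.uncurry f) := contDiff_infty.mp hf 2
  have hf1 : ContDiff ℝ 1 (Function.uncurry f) := hf2.of_le (by norm_num)
  have h := integral_integral_deriv_left_mul (g := fun s t => f s t - mproj2 f k s t)
    (hf1.sub (contDiff_mproj2 f k)) (continuous_const (y := (1 : ℝ))) (-1) 1 (-1) 1
  simp only [mul_one] at h
  have hp (s : ℝ) : Continuous (mproj2 f k s) :=
    (contDiff_section_right (contDiff_mproj2 f k (r := 1)) s).continuous
  have hc (s : ℝ) : Continuous (f s) := (contDiff_section_right hf1 s).continuous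
  have h2 : ∫ t in (-1:ℝ)..1, (f 1 t - mproj2 f k 1 t - (f (-1) t - mproj2 f k (-1) t)) =
      (∫ t in (-1:ℝ)..1, (f 1 t - f (-1) t)) -
        ∫ t in (-1:ℝ)..1, (mproj2 f k 1 t - mproj2 f k (-1) t) := by
    rw [← intervalIntegral.integral_sub (Continuous.intervalIntegrable (by fun_prop) _ _)
      (Continuous.intervalIntegrable (by fun_prop) _ _)]
    congr 1
    funext t
    ring
  rw [h, h2, integral_mproj2_one_sub f hk, mcoeff2_one_zero hf1, mcoeff2_one_two hf2]
  ring
end
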